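/- Let Γ = ℤ^d and let A: ℝ^d → Sym_d(ℝ) be a smooth Γ-periodic matrix field of the form A = cofactor(S + ∇²ψ), where S ∈ Sym_d(ℝ), ψ is a smooth Γ-periodic function, and x ↦ (1/2)x^T S x + ψ(x) is convex. Then the average over a fundamental domain of (det A)^{1/(d-1)} equals (det of the average of A)^{1/(d-1)}; both sides equal det S and (det Ŝ)^{1/(d-1)} respectively, where Ŝ is the cofactor matrix of S. -/

import Mathlib

open Matrix MeasureTheory

/-- The Hessian matrix of a function `ψ : ℝ^d → ℝ` at a point `x`. -/
noncomputable def hessianMatrix' {d : ℕ} (ψ : (Fin d → ℝ) → ℝ) (x : Fin d → ℝ) :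
    Matrix (Fin d) (Fin d) ℝ :=
  Matrix.of fun i j =>
    fderiv ℝ (fun y => fderiv ℝ ψ y (Pi.single i 1)) x (Pi.single j 1)

/-- The vector of partial derivatives of a function on `ℝ^d`. -/
noncomputable def partials {d : ℕ} (f : (Fin d → ℝ) → ℝ) (x : Fin d → ℝ) : Fin d → ℝ :=
  fun j => fderiv ℝ f x (Pi.single j 1)

/-- The determinant as a continuous multilinear function of the rows. -/
noncomputable def detRowsCLM (d : ℕ) :
    ContinuousMultilinearMap ℝ (fun _ : Fin d => Fin d → ℝ) ℝ where
  toMultilinearMap := (Matrix.detRowAlternating (n := Fin d) (R := ℝ)).toMultilinearMap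
  cont := by
    change Continuous fun M : Matrix (Fin d) (Fin d) ℝ => M.det
    exact continuous_id.matrix_det

lemma detRowsCLM_apply {d : ℕ} (M : Matrix (Fin d) (Fin d) ℝ) : detRowsCLM d M = M.det := rfl

/-- Invariance of a function on `ℝ^d` under translation by `ℤ^d`. -/
def LatticePeriodic {d : ℕ} {E : Type*} (f : (Fin d → ℝ) → E) : Prop :=
  ∀ (x : Fin d → ℝ) (k : Fin d → ℤ), f (x + fun i => (k i : ℝ)) = f x

lemma LatticePeriodic.fderiv {d : ℕ} {f : (Fin d → ℝ) → ℝ} (hf : LatticePeriodic f) :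
    LatticePeriodic (fderiv ℝ f) := by
  intro x k
  rw [← fderiv_comp_add_right]
  exact congrArg (fun g => _root_.fderiv ℝ g x) (funext fun y => hf y k)

lemma LatticePeriodic.partials {d : ℕ} {f : (Fin d → ℝ) → ℝ} (hf : LatticePeriodic f) :
    LatticePeriodic (partials f) := by
  intro x k
  ext j
  exact congrArg (fun L => L (Pi.single j 1)) (hf.fderiv x k)

lemma contDiff_partials {d : ℕ} {f : (Fin d → ℝ) → ℝ} (hf : ContDiff ℝ (⊤ : ℕ∞) f) :
    ContDiff ℝ (⊤ : ℕ∞) (partials f) := by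
  refine contDiff_pi.2 fun j => ?_
  exact (hf.fderiv_right (m := (⊤ : ℕ∞)) (by simp)).clm_apply contDiff_const

lemma fderiv_partials_apply {d : ℕ} {f : (Fin d → ℝ) → ℝ} (hf : ContDiff ℝ (⊤ : ℕ∞) f)
    (x v : Fin d → ℝ) (l : Fin d) :
    fderiv ℝ (partials f) x v l = fderiv ℝ (fderiv ℝ f) x v (Pi.single l 1) := by
  have h : DifferentiableAt ℝ (fderiv ℝ f) x :=
    ((hf.fderiv_right (m := (⊤ : ℕ∞)) (by simp)).differentiable (by simp)) x
  have h2 : HasFDerivAt (partials f) (ContinuousLinearMap.pi fun l =>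
      (fderiv ℝ (fderiv ℝ f) x).flip (Pi.single l 1)) x := by
    refine hasFDerivAt_pi.2 fun l => ?_
    simpa [partials] using h.hasFDerivAt.clm_apply (hasFDerivAt_const (Pi.single l (1 : ℝ)) x)
  rw [h2.fderiv]
  simp

lemma fderiv_fderiv_comm {d : ℕ} {f : (Fin d → ℝ) → ℝ} (hf : ContDiff ℝ (⊤ : ℕ∞) f)
    (x v w : Fin d → ℝ) :
    fderiv ℝ (fderiv ℝ f) x v w = fderiv ℝ (fderiv ℝ f) x w v :=
  (hf.contDiffAt.isSymmSndFDerivAt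
    (by simpa using WithTop.coe_le_coe.2 (le_top : (2 : ℕ∞) ≤ ⊤))).eq v w

/-- The integral over the unit cube of the divergence of a periodic field vanishes. -/
lemma integral_divergence_eq_zero_of_periodic {d : ℕ} (G : Fin d → (Fin d → ℝ) → ℝ)
    (hG : ∀ j, ContDiff ℝ (⊤ : ℕ∞) (G j)) (hper : ∀ j, LatticePeriodic (G j)) :
    ∫ x in Set.Icc (0 : Fin d → ℝ) 1, ∑ j, fderiv ℝ (G j) x (Pi.single j 1) = 0 := by
  cases d with
  | zero => simp
  | succ n =>
    have hcont : Continuous fun x => ∑ j, fderiv ℝ (G j) x (Pi.single j 1) :=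
      continuous_finsetSum _ fun j _ =>
        ((hG j).continuous_fderiv (by simp)).clm_apply continuous_const
    rw [integral_divergence_of_hasFDerivAt_off_countable' 0 1 (fun _ => zero_le_one) G
      (fun j => fderiv ℝ (G j)) ∅ Set.countable_empty (fun j => (hG j).continuous.continuousOn)
      (fun x _ j => ((hG j).differentiable (by simp) x).hasFDerivAt)
      (hcont.continuousOn.integrableOn_compact isCompact_Icc)]
    refine Finset.sum_eq_zero fun j _ => sub_eq_zero.2 ?_
    refine integral_congr_ae (Filter.Eventually.of_forall fun y => ?_)
    have h := hper j (j.insertNth (α := fun _ => ℝ) 0 y) (Pi.single j 1)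
    refine Eq.trans (congrArg (G j) ?_) h
    ext l
    refine Fin.succAboveCases j ?_ (fun m => ?_) l <;> simp

lemma detRowsCLM_map_update_sum {d : ℕ} (r : Fin d → Fin d → ℝ) (i : Fin d)
    (a : Fin d → Fin d → ℝ) :
    detRowsCLM d (Function.update r i (∑ j, a j))
      = ∑ j, detRowsCLM d (Function.update r i (a j)) :=
  (detRowsCLM d).toMultilinearMap.map_update_sum Finset.univ i a r

lemma det_update_update_swap {d : ℕ} (r : Fin d → Fin d → ℝ) {i k : Fin d} (hik : i ≠ k)
    (a b : Fin d → ℝ) :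
    detRowsCLM d (Function.update (Function.update r i a) k b)
      = - detRowsCLM d (Function.update (Function.update r i b) k a) := by
  have h := (Matrix.detRowAlternating (n := Fin d) (R := ℝ)).map_swap
    (Function.update (Function.update r i b) k a) hik
  refine Eq.trans (congrArg (detRowsCLM d) ?_) h
  ext l m
  by_cases h1 : l = k
  · subst h1; simp [hik]
  · by_cases h2 : l = i
    · subst h2; simp [hik]
    · simp [h1, h2, Equiv.swap_apply_of_ne_of_ne h2 h1]

lemma sum_det_update_symm {d : ℕ} (r : Fin d → Fin d → ℝ) {i k : Fin d} (hik : i ≠ k)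
    (H : Fin d → Fin d → ℝ) (hH : ∀ j l, H j l = H l j) :
    ∑ j, detRowsCLM d (Function.update (Function.update r i (Pi.single j 1)) k (H j)) = 0 := by
  have h1 : ∀ j, detRowsCLM d (Function.update (Function.update r i (Pi.single j 1)) k (H j))
      = ∑ l, H j l * detRowsCLM d (Function.update (Function.update r i (Pi.single j 1)) k
          (Pi.single l 1)) := by
    intro j
    conv_lhs => rw [pi_eq_sum_univ' (H j)]
    rw [detRowsCLM_map_update_sum]
    refine Finset.sum_congr rfl fun l _ => ?_
    rw [ContinuousMultilinearMap.map_update_smul, smul_eq_mul]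
  simp_rw [h1]
  refine self_eq_neg.1 ?_
  conv_lhs => rw [Finset.sum_comm]
  rw [← Finset.sum_neg_distrib]
  refine Finset.sum_congr rfl fun j _ => ?_
  rw [← Finset.sum_neg_distrib]
  refine Finset.sum_congr rfl fun l _ => ?_
  rw [det_update_update_swap r hik, hH l j, mul_neg]

/-- A determinant of closed rows, one of which is an exact periodic differential,
has vanishing mean. -/
lemma integral_det_update_partials_eq_zero {d : ℕ} (c : Fin d → Fin d → ℝ)
    (u : Fin d → (Fin d → ℝ) → ℝ) (hu : ∀ k, ContDiff ℝ (⊤ : ℕ∞) (u k))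
    (hper : ∀ k, LatticePeriodic (u k)) (i : Fin d) :
    ∫ x in Set.Icc (0 : Fin d → ℝ) 1,
      detRowsCLM d (Function.update (fun k => c k + partials (u k) x) i (partials (u i) x)) = 0 := by
  let P : Fin d → Fin d → (Fin d → ℝ) → (Fin d → ℝ) := fun j =>
    Function.update (fun k x => c k + partials (u k) x) i (fun x => u i x • Pi.single j 1)
  have hPi : ∀ j, P j i = fun x => u i x • Pi.single j 1 := fun j => by simp [P]
  have hPk : ∀ j k, k ≠ i → P j k = fun x => c k + partials (u k) x := fun j k hk => by
    simp [P, hk]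
  have hP : ∀ j k, ContDiff ℝ (⊤ : ℕ∞) (P j k) := by
    intro j k
    by_cases hk : k = i
    · subst hk; rw [hPi]; exact (hu k).smul contDiff_const
    · rw [hPk j k hk]; exact contDiff_const.add (contDiff_partials (hu k))
  have hPper : ∀ j k, LatticePeriodic (P j k) := by
    intro j k x n
    by_cases hk : k = i
    · subst hk; simp only [hPi, hper k x n]
    · simp only [hPk j k hk, (hper k).partials x n]
  have hPupd : ∀ j x, (fun k => P j k x)
      = Function.update (fun k => c k + partials (u k) x) i (u i x • Pi.single j 1) := by
    intro j x
    ext k : 1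
    by_cases hk : k = i
    · subst hk; simp [hPi]
    · simp [hPk j k hk, hk]
  have key := integral_divergence_eq_zero_of_periodic
    (fun j x => detRowsCLM d fun k => P j k x)
    (fun j => (detRowsCLM d).contDiff.comp (contDiff_pi.2 fun k => hP j k))
    (fun j x n => by simp only [hPper j _ x n])
  rw [← key]
  refine integral_congr_ae (Filter.Eventually.of_forall fun x => ?_)
  have hd : ∀ j, fderiv ℝ (fun x => detRowsCLM d fun k => P j k x) x (Pi.single j 1)
      = ∑ k, detRowsCLM d (Function.update (fun k => P j k x) k
          (fderiv ℝ (P j k) x (Pi.single j 1))) := by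
    intro j
    rw [(HasFDerivAt.multilinear_comp (f := detRowsCLM d) fun k =>
      ((hP j k).differentiable (by simp) x).hasFDerivAt).fderiv]
    simp [ContinuousMultilinearMap.toContinuousLinearMap]
  simp only [hd]
  rw [Finset.sum_comm, Finset.sum_eq_single i]
  · have hpi : ∀ j, fderiv ℝ (P j i) x (Pi.single j 1)
        = partials (u i) x j • Pi.single j 1 := by
      intro j
      rw [hPi, fderiv_smul_const ((hu i).differentiable (by simp) x)]
      simp [partials]
    simp only [hpi, hPupd, Function.update_idem]
    rw [← detRowsCLM_map_update_sum, ← pi_eq_sum_univ']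
  · intro k _ hk
    have hpk : ∀ j, fderiv ℝ (P j k) x (Pi.single j 1)
        = fderiv ℝ (partials (u k)) x (Pi.single j 1) := by
      intro j
      rw [hPk j k hk, fderiv_const_add]
    simp only [hpk, hPupd]
    have hsm : ∀ j, detRowsCLM d (Function.update (Function.update
          (fun k => c k + partials (u k) x) i (u i x • Pi.single j 1)) k
            (fderiv ℝ (partials (u k)) x (Pi.single j 1)))
        = u i x * detRowsCLM d (Function.update (Function.update
          (fun k => c k + partials (u k) x) i (Pi.single j 1)) k
            (fderiv ℝ (partials (u k)) x (Pi.single j 1))) := by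
      intro j
      rw [Function.update_comm hk.symm, ContinuousMultilinearMap.map_update_smul,
        Function.update_comm hk, smul_eq_mul]
    simp only [hsm, ← Finset.mul_sum]
    rw [sum_det_update_symm _ hk.symm, mul_zero]
    intro j l
    rw [fderiv_partials_apply (hu k), fderiv_partials_apply (hu k), fderiv_fderiv_comm (hu k)]
  · simp

/-- The determinant is a null Lagrangian. -/
lemma integral_det_add_partials {d : ℕ} (c : Fin d → Fin d → ℝ)
    (u : Fin d → (Fin d → ℝ) → ℝ) (hu : ∀ k, ContDiff ℝ (⊤ : ℕ∞) (u k))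
    (hper : ∀ k, LatticePeriodic (u k)) :
    ∫ x in Set.Icc (0 : Fin d → ℝ) 1, detRowsCLM d (fun k => c k + partials (u k) x)
      = detRowsCLM d c := by
  suffices H : ∀ (s : Finset (Fin d)) (u : Fin d → (Fin d → ℝ) → ℝ),
      (∀ k, ContDiff ℝ (⊤ : ℕ∞) (u k)) → (∀ k, LatticePeriodic (u k)) → (∀ k ∉ s, u k = 0) →
      ∫ x in Set.Icc (0 : Fin d → ℝ) 1, detRowsCLM d (fun k => c k + partials (u k) x)
        = detRowsCLM d c from
    H Finset.univ u hu hper (by simp)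
  intro s
  induction s using Finset.induction_on with
  | empty =>
    intro u _ _ h0
    have h0' : ∀ k x, partials (u k) x = 0 := by
      intro k x
      ext j
      simp [partials, h0 k]
    simp [h0', Measure.real, Real.volume_Icc_pi]
  | insert i s _ ih =>
    intro u hu hper h0
    have hsplit : ∀ x, detRowsCLM d (fun k => c k + partials (u k) x)
        = detRowsCLM d (fun k => c k + partials (Function.update u i 0 k) x)
          + detRowsCLM d (Function.update (fun k => c k + partials (u k) x) i
              (partials (u i) x)) := by
      intro x
      have h1 : (fun k => c k + partials (u k) x)
          = Function.update (fun k => c k + partials (u k) x) i (c i + partials (u i) x) := by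
        simp
      have h2 : (fun k => c k + partials (Function.update u i 0 k) x)
          = Function.update (fun k => c k + partials (u k) x) i (c i) := by
        ext k l
        by_cases hk : k = i
        · subst hk; simp [partials]
        · simp [hk]
      rw [h2, ← ContinuousMultilinearMap.map_update_add, ← h1]
    have hu' : ∀ k, ContDiff ℝ (⊤ : ℕ∞) (Function.update u i 0 k) := by
      intro k
      by_cases hk : k = i
      · subst hk; rw [Function.update_self]; exact contDiff_const
      · simpa [hk] using hu k
    have hcont : ∀ w : Fin d → (Fin d → ℝ) → ℝ, (∀ k, ContDiff ℝ (⊤ : ℕ∞) (w k)) →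
        Continuous fun x => fun k => c k + partials (w k) x := fun w hw =>
      continuous_pi fun k => continuous_const.add (contDiff_partials (hw k)).continuous
    simp only [hsplit]
    rw [integral_add, integral_det_update_partials_eq_zero c u hu hper i, add_zero]
    · refine ih _ hu' ?_ ?_
      · intro k
        by_cases hk : k = i
        · subst hk; intro x n; simp
        · simpa [hk] using hper k
      · intro k hk
        by_cases hki : k = i
        · subst hki; simp
        · simpa [hki] using h0 k (by simp [hki, hk])
    · exact ((detRowsCLM d).cont.comp (hcont _ hu')).continuousOn.integrableOn_compact
        isCompact_Icc
    · exact ((detRowsCLM d).cont.comp ((hcont _ hu).update i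
        (contDiff_partials (hu i)).continuous)).continuousOn.integrableOn_compact isCompact_Icc

lemma hessianMatrix'_apply {d : ℕ} {ψ : (Fin d → ℝ) → ℝ} (hψ : ContDiff ℝ (⊤ : ℕ∞) ψ)
    (x : Fin d → ℝ) (i j : Fin d) :
    hessianMatrix' ψ x i j = fderiv ℝ (fderiv ℝ ψ) x (Pi.single i 1) (Pi.single j 1) := by
  have h : DifferentiableAt ℝ (fderiv ℝ ψ) x :=
    ((hψ.fderiv_right (m := (⊤ : ℕ∞)) (by simp)).differentiable (by simp)) x
  have h2 := h.hasFDerivAt.clm_apply (hasFDerivAt_const (Pi.single i (1 : ℝ)) x)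
  rw [hessianMatrix', Matrix.of_apply, h2.fderiv, fderiv_fderiv_comm hψ]
  simp

lemma dotProduct_hessianMatrix'_mulVec {d : ℕ} {ψ : (Fin d → ℝ) → ℝ}
    (hψ : ContDiff ℝ (⊤ : ℕ∞) ψ) (x v : Fin d → ℝ) :
    v ⬝ᵥ (hessianMatrix' ψ x).mulVec v = fderiv ℝ (fderiv ℝ ψ) x v v := by
  conv_rhs => rw [pi_eq_sum_univ' v]
  simp only [map_sum, map_smul, _root_.sum_apply, _root_.smul_apply, dotProduct,
    Matrix.mulVec, hessianMatrix'_apply hψ, smul_eq_mul, Finset.mul_sum]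
  rw [Finset.sum_comm]
  refine Finset.sum_congr rfl fun i _ => Finset.sum_congr rfl fun j _ => ?_
  ring

/-- The Hessian matrix of a smooth convex function that is the sum of a quadratic form and `ψ` is
positive semidefinite. -/
lemma posSemidef_add_hessianMatrix' {d : ℕ} {S : Matrix (Fin d) (Fin d) ℝ} (hS : S.IsSymm)
    {ψ : (Fin d → ℝ) → ℝ} (hψ : ContDiff ℝ (⊤ : ℕ∞) ψ)
    (hconv : ConvexOn ℝ Set.univ
      (fun x : Fin d → ℝ => (1 / 2 : ℝ) * (x ⬝ᵥ S.mulVec x) + ψ x)) (x : Fin d → ℝ) :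
    (S + hessianMatrix' ψ x).PosSemidef := by
  refine Matrix.PosSemidef.of_dotProduct_mulVec_nonneg ?_ fun v => ?_
  · ext i j
    simp only [conjTranspose_apply, Matrix.add_apply, hessianMatrix'_apply hψ, star_trivial,
      hS.apply i j, fderiv_fderiv_comm hψ x (Pi.single j 1)]
  rw [star_trivial, Matrix.add_mulVec, dotProduct_add, dotProduct_hessianMatrix'_mulVec hψ]
  set γ : ℝ → Fin d → ℝ := fun t => x + t • v with hγ
  have hγ' : ∀ t, HasDerivAt γ v t := fun t => by
    simpa [hγ] using ((hasDerivAt_id t).smul_const v).const_add x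
  set b : ℝ := x ⬝ᵥ S.mulVec v + v ⬝ᵥ S.mulVec x with hb
  set c : ℝ := v ⬝ᵥ S.mulVec v with hc
  let g : ℝ → ℝ := fun t => (1 / 2 : ℝ) * (γ t ⬝ᵥ S.mulVec (γ t)) + ψ (γ t)
  have hgconv : ConvexOn ℝ Set.univ g := by
    have h := hconv.comp_affineMap (AffineMap.lineMap x (x + v) : ℝ →ᵃ[ℝ] (Fin d → ℝ))
    have hline : ∀ t, AffineMap.lineMap x (x + v) t = γ t := fun t => by
      simp [AffineMap.lineMap_apply, hγ, add_comm]
    simpa only [Function.comp_def, hline, Set.preimage_univ] using h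
  have hg : ∀ t, HasDerivAt g (b / 2 + t * c + fderiv ℝ ψ (γ t) v) t := by
    intro t
    have hquad : ∀ t, γ t ⬝ᵥ S.mulVec (γ t) = x ⬝ᵥ S.mulVec x + t * b + t ^ 2 * c := fun t => by
      simp only [hγ, hb, hc, Matrix.mulVec_add, Matrix.mulVec_smul, add_dotProduct, dotProduct_add,
        smul_dotProduct, dotProduct_smul, smul_eq_mul]
      ring
    have h1 : HasDerivAt (fun t : ℝ => (1 / 2 : ℝ) * (x ⬝ᵥ S.mulVec x + t * b + t ^ 2 * c))
        (b / 2 + t * c) t := by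
      have := ((((hasDerivAt_id t).mul_const b).const_add (x ⬝ᵥ S.mulVec x)).add
        (((hasDerivAt_id t).pow 2).mul_const c)).const_mul (1 / 2 : ℝ)
      refine HasDerivAt.congr_deriv this ?_
      simp
      ring
    have h2 := ((hψ.differentiable (by simp) (γ t)).hasFDerivAt).comp_hasDerivAt t (hγ' t)
    simp only [← hquad] at h1
    exact h1.add h2
  have hderiv : deriv g = fun t => b / 2 + t * c + fderiv ℝ ψ (γ t) v :=
    funext fun t => (hg t).deriv
  have hmono : Monotone (deriv g) :=
    monotoneOn_univ.1 (hgconv.monotoneOn_deriv fun t _ => (hg t).differentiableAt)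
  have hg2 : HasDerivAt (deriv g) (c + fderiv ℝ (fderiv ℝ ψ) x v v) 0 := by
    have h : DifferentiableAt ℝ (fderiv ℝ ψ) (γ 0) :=
      ((hψ.fderiv_right (m := (⊤ : ℕ∞)) (by simp)).differentiable (by simp)) _
    have h1 := (h.hasFDerivAt.comp_hasDerivAt 0 (hγ' 0)).clm_apply (hasDerivAt_const 0 v)
    have h2 := (((hasDerivAt_id (0 : ℝ)).mul_const c).const_add (b / 2)).add h1
    rw [hderiv]
    refine HasDerivAt.congr_deriv h2 ?_
    simp [hγ]
  have h := hmono.deriv_nonneg (x := 0)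
  rwa [hg2.deriv] at h

/-- Replacing a row by a constant preserves the null Lagrangian identity for Hessians. -/
lemma integral_det_updateRow_add_hessianMatrix' {d : ℕ} (S : Matrix (Fin d) (Fin d) ℝ)
    {ψ : (Fin d → ℝ) → ℝ} (hψ : ContDiff ℝ (⊤ : ℕ∞) ψ) (hper : LatticePeriodic ψ)
    (j : Fin d) (w : Fin d → ℝ) :
    ∫ x in Set.Icc (0 : Fin d → ℝ) 1, ((S + hessianMatrix' ψ x).updateRow j w).det
      = (S.updateRow j w).det := by
  have h := integral_det_add_partials (S.updateRow j w)
    (Function.update (fun k y => partials ψ y k) j 0) (fun k => ?_) (fun k => ?_)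
  · rw [← detRowsCLM_apply, ← h]
    refine integral_congr_ae (Filter.Eventually.of_forall fun x => ?_)
    refine (congrArg (detRowsCLM d) ?_ : detRowsCLM d _ = _)
    ext k l
    by_cases hk : k = j
    · subst hk; simp [partials]
    · simp [hk, hessianMatrix', partials]
  · by_cases hk : k = j
    · subst hk; rw [Function.update_self]; exact contDiff_const
    · simpa [hk] using contDiff_pi.1 (contDiff_partials hψ) k
  · intro x n
    by_cases hk : k = j
    · subst hk; simp
    · simp [hk, hper.partials x n]

lemma integral_det_add_hessianMatrix' {d : ℕ} (S : Matrix (Fin d) (Fin d) ℝ)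
    {ψ : (Fin d → ℝ) → ℝ} (hψ : ContDiff ℝ (⊤ : ℕ∞) ψ) (hper : LatticePeriodic ψ) :
    ∫ x in Set.Icc (0 : Fin d → ℝ) 1, (S + hessianMatrix' ψ x).det = S.det :=
  integral_det_add_partials S (fun k y => partials ψ y k)
    (fun k => contDiff_pi.1 (contDiff_partials hψ) k)
    (fun k x n => by simp only [hper.partials x n])

theorem stmt19 (d : ℕ) (hd : 2 ≤ d)
    (S : Matrix (Fin d) (Fin d) ℝ) (hS : S.IsSymm)
    (ψ : (Fin d → ℝ) → ℝ) (hψ : ContDiff ℝ (⊤ : ℕ∞) ψ)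
    (hper : ∀ (x : Fin d → ℝ) (k : Fin d → ℤ), ψ (x + fun i => (k i : ℝ)) = ψ x)
    (hconv : ConvexOn ℝ Set.univ
      (fun x : Fin d → ℝ => (1 / 2 : ℝ) * (x ⬝ᵥ S.mulVec x) + ψ x))
    (A : (Fin d → ℝ) → Matrix (Fin d) (Fin d) ℝ)
    (hA : ∀ x, A x = (S + hessianMatrix' ψ x).adjugate)
    (Abar : Matrix (Fin d) (Fin d) ℝ)
    (hAbar : Abar = Matrix.of fun i j =>
      ∫ x in Set.Icc (0 : Fin d → ℝ) 1, A x i j) :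
    (∫ x in Set.Icc (0 : Fin d → ℝ) 1, (A x).det ^ ((1:ℝ)/(d-1)))
        = Abar.det ^ ((1:ℝ)/(d-1)) ∧
    (∫ x in Set.Icc (0 : Fin d → ℝ) 1, (A x).det ^ ((1:ℝ)/(d-1))) = S.det ∧
    Abar.det ^ ((1:ℝ)/(d-1)) = S.adjugate.det ^ ((1:ℝ)/(d-1)) := by
  have hroot : ∀ M : Matrix (Fin d) (Fin d) ℝ, 0 ≤ M.det →
      M.adjugate.det ^ ((1:ℝ)/(d-1)) = M.det := by
    intro M hM
    have hcast : ((d : ℝ) - 1) = ((d - 1 : ℕ) : ℝ) := by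
      rw [Nat.cast_sub (by omega), Nat.cast_one]
    rw [Matrix.det_adjugate, Fintype.card_fin, hcast, one_div,
      Real.pow_rpow_inv_natCast hM (by omega)]
  have hpos : ∀ x, 0 ≤ (S + hessianMatrix' ψ x).det := fun x =>
    (posSemidef_add_hessianMatrix' hS hψ hconv x).det_nonneg
  have hdet := integral_det_add_hessianMatrix' S hψ hper
  have hSdet : 0 ≤ S.det := hdet ▸ integral_nonneg hpos
  have hbar : Abar = S.adjugate := by
    ext i j
    simp only [hAbar, hA, Matrix.of_apply, Matrix.adjugate_apply]
    exact integral_det_updateRow_add_hessianMatrix' S hψ hper j _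
  have hleft : ∫ x in Set.Icc (0 : Fin d → ℝ) 1, (A x).det ^ ((1:ℝ)/(d-1)) = S.det := by
    simp only [hA, hroot _ (hpos _), hdet]
  refine ⟨?_, hleft, by rw [hbar]⟩
  rw [hleft, hbar, hroot S hSdet]
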